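/- Let G be a group, H ≤ G a subgroup, F a field, and suppose the pair (FG, FG − {0}) satisfies the right Ore condition with FG a domain, so that the Ore localization D = FG(FG−{0})⁻¹ is a skew field. If [G : H] = n < ∞ and S = FH − {0} satisfies the Ore condition in FG, then the localization (FG)S⁻¹ is isomorphic to D, and D is a left vector space of dimension n over the division closure of FH. -/

import Mathlib

open OreLocalization

/-- The division closure of a subset `s` of a division ring `D`: the smallest subring of
`D` containing `s` and closed under inverses. -/
def divisionClosure {D : Type*} [DivisionRing D] (s : Set D) : Subring D :=
  sInf {T : Subring D | s ⊆ ↑T ∧ ∀ x ∈ T, x⁻¹ ∈ T}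

/-- The image in `F[G]` of the set of nonzero elements of the group algebra `F[H]` of a
subgroup `H ≤ G`, as a submonoid of `F[G]`. -/
noncomputable def mappedNonzero (F : Type*) [Field F] {G : Type*} [Group G] (H : Subgroup G)
    [IsDomain (MonoidAlgebra F ↥H)] : Submonoid (MonoidAlgebra F G) :=
  Submonoid.map
    (MonoidAlgebra.mapDomainRingHom F H.subtype :
      MonoidAlgebra F ↥H →+* MonoidAlgebra F G).toMonoidHom
    (nonZeroDivisors (MonoidAlgebra F ↥H))

/-- The subring of left fractions. -/
def fracSubring {A D : Type*} [Ring A] [IsDomain A] [DivisionRing D] (f : A →+* D)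
    (hf : Function.Injective f)
    (ore : ∀ r s : A, s ≠ 0 → ∃ r' s' : A, s' ≠ 0 ∧ s' * r = r' * s) : Subring D where
  carrier := {x | ∃ s h : A, s ≠ 0 ∧ f s * x = f h}
  zero_mem' := ⟨1, 0, one_ne_zero, by simp⟩
  one_mem' := ⟨1, 1, one_ne_zero, by simp⟩
  neg_mem' := by
    rintro x ⟨s, h, hs, e⟩
    exact ⟨s, -h, hs, by simp [e]⟩
  mul_mem' := by
    rintro x y ⟨s, h, hs, e⟩ ⟨t, k, ht, e'⟩
    obtain ⟨r', s', hs', o⟩ := ore h t ht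
    refine ⟨s' * s, r' * k, mul_ne_zero hs' hs, ?_⟩
    calc f (s' * s) * (x * y) = f s' * (f s * x) * y := by rw [map_mul]; noncomm_ring
      _ = f (s' * h) * y := by rw [e, map_mul]
      _ = f r' * (f t * y) := by rw [o, map_mul, mul_assoc]
      _ = _ := by rw [e', map_mul]
  add_mem' := by
    rintro x y ⟨s, h, hs, e⟩ ⟨t, k, ht, e'⟩
    obtain ⟨r', s', hs', o⟩ := ore s t ht
    refine ⟨s' * s, s' * h + r' * k, mul_ne_zero hs' hs, ?_⟩
    rw [mul_add]
    nth_rewrite 2 [o]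
    rw [map_mul, map_mul, mul_assoc, mul_assoc, e, e', map_add, map_mul, map_mul]

theorem fracSubring_inv {A D : Type*} [Ring A] [IsDomain A] [DivisionRing D] (f : A →+* D)
    (hf : Function.Injective f)
    (ore : ∀ r s : A, s ≠ 0 → ∃ r' s' : A, s' ≠ 0 ∧ s' * r = r' * s) (x : D)
    (hx : x ∈ fracSubring f hf ore) : x⁻¹ ∈ fracSubring f hf ore := by
  by_cases h0 : x = 0
  · simpa [h0] using hx
  obtain ⟨s, h, hs, e⟩ := hx
  refine ⟨h, s, ?_, ?_⟩
  · rintro rfl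
    rw [map_zero, mul_eq_zero] at e
    rcases e with e | e
    · exact hs (hf (by simpa using e))
    · exact h0 e
  · rw [← e, mul_assoc, mul_inv_cancel₀ h0, mul_one]

theorem divisionClosure_sub {D : Type*} [DivisionRing D] (s : Set D) :
    s ⊆ divisionClosure s := by
  intro x hx
  simp only [divisionClosure, SetLike.mem_coe, Subring.mem_sInf]
  exact fun T hT => hT.1 hx

theorem divisionClosure_inv {D : Type*} [DivisionRing D] (s : Set D) (x : D)
    (hx : x ∈ divisionClosure s) : x⁻¹ ∈ divisionClosure s := by
  simp only [divisionClosure, Subring.mem_sInf] at hx ⊢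
  exact fun T hT => hT.2 x (hx T hT)

theorem divisionClosure_frac {A D : Type*} [Ring A] [IsDomain A] [DivisionRing D] (f : A →+* D)
    (hf : Function.Injective f)
    (ore : ∀ r s : A, s ≠ 0 → ∃ r' s' : A, s' ≠ 0 ∧ s' * r = r' * s) (x : D)
    (hx : x ∈ divisionClosure (Set.range f)) : ∃ s h : A, s ≠ 0 ∧ f s * x = f h := by
  have : divisionClosure (Set.range f) ≤ fracSubring f hf ore := by
    refine sInf_le ⟨?_, fracSubring_inv f hf ore⟩
    rintro _ ⟨a, rfl⟩
    exact ⟨1, a, one_ne_zero, by simp⟩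
  exact this hx

theorem common_denom {A D T : Type*} [Ring A] [IsDomain A] [DivisionRing D] (f : A →+* D)
    (ore : ∀ r s : A, s ≠ 0 → ∃ r' s' : A, s' ≠ 0 ∧ s' * r = r' * s) (k : T → D)
    (hk : ∀ i, ∃ s h : A, s ≠ 0 ∧ f s * k i = f h) (t : Finset T) :
    ∃ s : A, s ≠ 0 ∧ ∀ i ∈ t, ∃ h, f s * k i = f h := by
  classical
  induction t using Finset.induction_on with
  | empty => exact ⟨1, one_ne_zero, by simp⟩
  | insert a u ha ih =>
    obtain ⟨s, hs, H⟩ := ih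
    obtain ⟨t, h, ht, e⟩ := hk a
    obtain ⟨r', s', hs', o⟩ := ore s t ht
    refine ⟨s' * s, mul_ne_zero hs' hs, fun i hi => ?_⟩
    rcases Finset.mem_insert.1 hi with rfl | hi
    · exact ⟨r' * h, by rw [o, map_mul, mul_assoc, e, map_mul]⟩
    · obtain ⟨h', e'⟩ := H i hi
      exact ⟨s' * h', by rw [map_mul, mul_assoc, e', map_mul]⟩

/-- Right multiplication as a left linear map. -/
def rmul {D : Type*} [Ring D] (K : Subring D) (t : D) : D →ₗ[K] D where
  toFun x := x * t
  map_add' x y := add_mul x y t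
  map_smul' c x := by simp [Subring.smul_def, mul_assoc]

theorem strongRank_of_inv {D : Type*} [DivisionRing D] (K : Subring D)
    (hK : ∀ x ∈ K, x⁻¹ ∈ K) : StrongRankCondition K := by
  letI : DivisionRing K := DivisionRing.ofIsUnitOrEqZero (by
    intro a
    by_cases h : a = 0
    · exact Or.inr h
    · left
      have h' : (a : D) ≠ 0 := by simpa using h
      exact ⟨⟨a, ⟨_, hK a a.2⟩, Subtype.ext (by simp [h']), Subtype.ext (by simp [h'])⟩, rfl⟩)
  infer_instance

theorem span_top {D T : Type*} [DivisionRing D] [Finite T] (K : Subring D)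
    (hK : ∀ x ∈ K, x⁻¹ ∈ K) {B : Type*} [Ring B] (ι : B →+* D)
    (hfr : ∀ x : D, ∃ t r : B, ι t ≠ 0 ∧ ι t * x = ι r)
    (g : T → B) (hspan : ∀ b, ι b ∈ Submodule.span K (Set.range (fun i => ι (g i)))) :
    Submodule.span K (Set.range (fun i => ι (g i))) = ⊤ := by
  letI : DivisionRing K := DivisionRing.ofIsUnitOrEqZero (by
    intro a
    by_cases h : a = 0
    · exact Or.inr h
    · left
      have h' : (a : D) ≠ 0 := by simpa using h
      exact ⟨⟨a, ⟨_, hK a a.2⟩, Subtype.ext (by simp [h']), Subtype.ext (by simp [h'])⟩, rfl⟩)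
  set V := Submodule.span K (Set.range (fun i => ι (g i))) with hV
  haveI : FiniteDimensional K V := FiniteDimensional.span_of_finite K (Set.finite_range _)
  have hstab : ∀ t : B, ∀ v ∈ V, rmul K (ι t) v ∈ V := by
    intro t
    suffices h : V ≤ V.comap (rmul K (ι t)) from fun v hv => h hv
    refine Submodule.span_le.2 ?_
    rintro _ ⟨i, rfl⟩
    change ι (g i) * ι t ∈ V
    rw [← map_mul]
    exact hspan _
  rw [eq_top_iff]
  intro x _
  obtain ⟨t, r, ht, e⟩ := hfr x
  have hinj : Function.Injective ((rmul K (ι t)).restrict (hstab t)) := by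
    intro v w h
    have : (v : D) * ι t = w * ι t := congrArg Subtype.val h
    exact Subtype.ext (mul_right_cancel₀ ht this)
  obtain ⟨v, hv⟩ := LinearMap.injective_iff_surjective.1 hinj ⟨1, by simpa using hspan 1⟩
  have hv' : (v : D) * ι t = 1 := congrArg Subtype.val hv
  have : x = rmul K (ι r) v := by
    change x = v * ι r
    rw [← e, ← mul_assoc, hv', one_mul]
  rw [this]
  exact hstab r v v.2

theorem abstract_main {A B D T : Type*} [Ring A] [IsDomain A] [Ring B] [DivisionRing D] [Fintype T]
    (j : A →+* B) (hj : Function.Injective j) (ι : B →+* D) (hι : Function.Injective ι)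
    (ore : ∀ r s : A, s ≠ 0 → ∃ r' s' : A, s' ≠ 0 ∧ s' * r = r' * s)
    (hfr : ∀ x : D, ∃ t r : B, ι t ≠ 0 ∧ ι t * x = ι r)
    (g : T → B)
    (hspan : ∀ b, ∃ c : T → A, b = ∑ i, j (c i) * g i)
    (hind : ∀ c : T → A, ∑ i, j (c i) * g i = 0 → c = 0) :
    (∀ x : D, ∃ s : A, ∃ b : B, s ≠ 0 ∧ ι (j s) * x = ι b) ∧
    Nonempty (Module.Basis T (divisionClosure (Set.range (ι.comp j))) D) := by
  have hf : Function.Injective (ι.comp j) := hι.comp hj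
  set K := divisionClosure (Set.range (ι.comp j)) with hKdef
  have hmem : ∀ a, ι (j a) ∈ K := fun a => divisionClosure_sub _ ⟨a, rfl⟩
  have hfrac := divisionClosure_frac (ι.comp j) hf ore
  have htop : Submodule.span K (Set.range (fun i => ι (g i))) = ⊤ := by
    refine span_top K (divisionClosure_inv _) ι hfr g fun b => ?_
    obtain ⟨c, rfl⟩ := hspan b
    rw [map_sum]
    refine Submodule.sum_mem _ fun i _ => ?_
    rw [map_mul]
    exact Submodule.smul_mem _ (⟨ι (j (c i)), hmem _⟩ : K) (Submodule.subset_span ⟨i, rfl⟩)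
  have hden : ∀ k : T → K, ∃ s : A, s ≠ 0 ∧ ∃ h : T → A, ∀ i, ι (j s) * k i = ι (j (h i)) := by
    intro k
    obtain ⟨s, hs, H⟩ := common_denom (ι.comp j) ore (fun i => (k i : D))
      (fun i => hfrac _ (k i).2) Finset.univ
    choose h hh using fun i => H i (Finset.mem_univ i)
    exact ⟨s, hs, h, hh⟩
  have hmul : ∀ (k : T → K) (s : A) (h : T → A), (∀ i, ι (j s) * k i = ι (j (h i))) →
      ι (j s) * ∑ i, k i • ι (g i) = ι (∑ i, j (h i) * g i) := by
    intro k s h hh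
    rw [Finset.mul_sum, map_sum]
    refine Finset.sum_congr rfl fun i _ => ?_
    rw [Subring.smul_def, smul_eq_mul, ← mul_assoc, hh, map_mul]
  refine ⟨fun x => ?_, ⟨Module.Basis.mk (v := fun i => ι (g i)) ?_ htop.ge⟩⟩
  · have hx : x ∈ Submodule.span K (Set.range (fun i => ι (g i))) := htop ▸ Submodule.mem_top
    obtain ⟨k, rfl⟩ := (Submodule.mem_span_range_iff_exists_fun K).1 hx
    obtain ⟨s, hs, h, hh⟩ := hden k
    exact ⟨s, _, hs, hmul k s h hh⟩
  · rw [Fintype.linearIndependent_iff]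
    intro k hk i
    obtain ⟨s, hs, h, hh⟩ := hden k
    have h1 := hmul k s h hh
    rw [hk, mul_zero] at h1
    have h2 := hind h (hι (by rw [← h1, map_zero]))
    have h3 := hh i
    rw [h2] at h3
    simp only [Pi.zero_apply, map_zero, mul_eq_zero] at h3
    rcases h3 with h3 | h3
    · exact absurd (hf (by simpa using h3)) hs
    · exact Subtype.ext h3

open MonoidAlgebra in
theorem comap_mul {F G : Type*} [Field F] [Group G] (H : Subgroup G)
    (y : MonoidAlgebra F G) (a : MonoidAlgebra F H) :
    comapDomain H.subtype H.subtype_injective (y * mapDomain H.subtype a) =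
    comapDomain H.subtype H.subtype_injective y * a := by
  let π := comapDomainAddMonoidHom (R := F) (f := H.subtype) H.subtype_injective
  have hπ : ∀ z, comapDomain H.subtype H.subtype_injective z = π z := fun _ => rfl
  simp only [hπ]
  induction a using MonoidAlgebra.induction_linear with
  | zero => simp
  | add p q hp hq => rw [mapDomain_add, mul_add, map_add, hp, hq, mul_add]
  | single h r =>
    ext x
    simp [π]

open MonoidAlgebra in
theorem exists_coords {F G : Type*} [Field F] [Group G] (H : Subgroup G) (T : Set G) [Fintype T]
    (hT : Subgroup.IsComplement (H : Set G) T) (b : MonoidAlgebra F G) :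
    ∃ c : T → MonoidAlgebra F H,
      b = ∑ i, mapDomainRingHom F H.subtype (c i) * single (i : G) 1 := by
  classical
  induction b using MonoidAlgebra.induction_linear with
  | zero => exact ⟨0, by simp⟩
  | add p q hp hq =>
    obtain ⟨c, hc⟩ := hp
    obtain ⟨d, hd⟩ := hq
    refine ⟨c + d, ?_⟩
    simp only [Pi.add_apply, map_add, add_mul, Finset.sum_add_distrib]
    rw [← hc, ← hd]
  | single g r =>
    obtain ⟨⟨h, t⟩, e, -⟩ := Subgroup.isComplement_iff_existsUnique.1 hT g
    refine ⟨Pi.single t (single (⟨h.1, h.2⟩ : H) r), ?_⟩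
    rw [Finset.sum_eq_single t]
    · rw [Pi.single_eq_same]
      change _ = mapDomain _ _ * _
      simp [mapDomain_single, single_mul_single, ← e]
    · intro i _ hi
      simp [Pi.single_eq_of_ne hi]
    · simp

open MonoidAlgebra in
theorem coords_zero {F G : Type*} [Field F] [Group G] (H : Subgroup G) (T : Set G) [Fintype T]
    (hT : Subgroup.IsComplement (H : Set G) T) (c : T → MonoidAlgebra F H)
    (h0 : ∑ i, mapDomainRingHom F H.subtype (c i) * single (i : G) 1 = 0) : c = 0 := by
  funext t
  ext h
  have h1 := congrArg (fun z : MonoidAlgebra F G => z.coeff ((h : G) * t)) h0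
  simp only [coeff_sum, Finsupp.finsetSum_apply, coeff_mul_single_apply, mul_one] at h1
  rw [Finset.sum_eq_single t] at h1
  · have : (mapDomainRingHom F H.subtype (c t)).coeff (h : G) = (c t).coeff h :=
      Finsupp.mapDomain_apply H.subtype_injective _ h
    rw [mul_inv_cancel_right, this] at h1
    simpa using h1
  · intro i _ hi
    refine Finsupp.mapDomain_of_notMem_range _ _ ?_
    rintro ⟨k, hk⟩
    apply hi
    have hk' : (k : G) * i = h * t := by
      have : (k : G) = h * t * (i : G)⁻¹ := hk
      rw [this]; group
    have := hT.1 (a₁ := (⟨k, k.2⟩, i)) (a₂ := (⟨h, h.2⟩, t)) hk'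
    exact (Prod.ext_iff.1 this).2
  · simp

set_option maxHeartbeats 1000000 in
set_option synthInstance.maxHeartbeats 400000 in
/-- Let `F` be a field, `G` a group with `F[G]` a domain satisfying the Ore condition with
respect to all nonzero elements, so that the Ore localization
`D = F[G][(F[G] − {0})⁻¹]` is a skew field.  Let `H ≤ G` have finite index `n` and suppose
`S = F[H] − {0}` (viewed inside `F[G]`) is an Ore set in `F[G]`.  Then the localization
`F[G][S⁻¹]` is isomorphic to `D`, and `D` is a left vector space of dimension `n` over the
division closure of `F[H]` in `D`. -/
theorem stmt6 (F : Type*) [Field F] {G : Type*} [Group G] (H : Subgroup G)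
    [IsDomain (MonoidAlgebra F G)] [IsDomain (MonoidAlgebra F ↥H)]
    [OreSet (nonZeroDivisors (MonoidAlgebra F G))]
    [OreSet (mappedNonzero F H)]
    (n : ℕ) (hn : n ≠ 0) (hidx : H.index = n) :
    Nonempty
      (OreLocalization (mappedNonzero F H) (MonoidAlgebra F G) ≃+*
        OreLocalization (nonZeroDivisors (MonoidAlgebra F G)) (MonoidAlgebra F G)) ∧
    (letI D := OreLocalization (nonZeroDivisors (MonoidAlgebra F G)) (MonoidAlgebra F G)
     letI dc : Subring D := divisionClosure
       (Set.range ((numeratorRingHom (R := MonoidAlgebra F G)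
            (S := nonZeroDivisors (MonoidAlgebra F G))).comp
          (MonoidAlgebra.mapDomainRingHom F H.subtype)))
     letI : Module ↥dc D := Module.compHom D dc.subtype
     Module.rank ↥dc D = n) := by
  classical
  set j := MonoidAlgebra.mapDomainRingHom F H.subtype with hjdef
  have hj : Function.Injective j := MonoidAlgebra.mapDomain_injective H.subtype_injective
  set ι := numeratorRingHom (R := MonoidAlgebra F G)
            (S := nonZeroDivisors (MonoidAlgebra F G)) with hιdef
  have hι : Function.Injective ι := numeratorHom_inj fun x hx => hx.1
  have hS : ∀ s, s ≠ 0 → j s ∈ mappedNonzero F H := fun s hs =>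
    ⟨s, mem_nonZeroDivisors_of_ne_zero hs, rfl⟩
  have hS' : ∀ s ∈ mappedNonzero F H, ∃ a, a ≠ 0 ∧ j a = s := by
    rintro _ ⟨a, ha, rfl⟩
    exact ⟨a, nonZeroDivisors.ne_zero ha, rfl⟩
  have ore : ∀ r s : MonoidAlgebra F H, s ≠ 0 → ∃ r' s', s' ≠ 0 ∧ s' * r = r' * s := by
    intro r s hs
    have e := ore_eq (j r) (⟨j s, hS s hs⟩ : mappedNonzero F H)
    obtain ⟨a, ha, ea⟩ := hS' _ (oreDenom (j r) (⟨j s, hS s hs⟩ : mappedNonzero F H)).2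
    rw [← ea, ← map_mul] at e
    refine ⟨MonoidAlgebra.comapDomain H.subtype H.subtype_injective
      (oreNum (j r) (⟨j s, hS s hs⟩ : mappedNonzero F H)), a, ha, ?_⟩
    · have e2 := congrArg (MonoidAlgebra.comapDomain H.subtype H.subtype_injective) e
      have e3 := comap_mul H 1 (a * r)
      have e4 := comap_mul H 1 (1 : MonoidAlgebra F H)
      rw [one_mul] at e3 e4
      have e5 : MonoidAlgebra.comapDomain H.subtype H.subtype_injective
        (1 : MonoidAlgebra F G) = 1 := by
        rw [MonoidAlgebra.one_def, MonoidAlgebra.one_def, ← H.subtype.map_one,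
          MonoidAlgebra.comapDomain_single_map]
      rw [e5, one_mul] at e3
      exact (e3.symm.trans e2).trans (comap_mul H _ s)
  have hfr : ∀ x : OreLocalization (nonZeroDivisors (MonoidAlgebra F G)) (MonoidAlgebra F G),
      ∃ t r, ι t ≠ 0 ∧ ι t * x = ι r := by
    intro x
    induction x using OreLocalization.ind with
    | _ r s =>
      refine ⟨s, r, ?_, ?_⟩
      · exact (map_ne_zero_iff ι hι).2 (nonZeroDivisors.ne_zero s.2)
      · change ((s : MonoidAlgebra F G) /ₒ 1) * (r /ₒ s) = r /ₒ 1
        exact OreLocalization.mul_cancel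
  obtain ⟨T, hT, -⟩ := H.exists_isComplement_right 1
  have hcard := hT.card_right
  rw [hidx] at hcard
  haveI : Finite T := Nat.finite_of_card_ne_zero (by rw [hcard]; exact hn)
  letI : Fintype T := Fintype.ofFinite T
  obtain ⟨h1, ⟨b⟩⟩ := abstract_main j hj ι hι ore hfr
    (fun t : T => MonoidAlgebra.single (t : G) 1) (exists_coords H T hT) (coords_zero H T hT)
  constructor
  · have hne : ∀ s : mappedNonzero F H, ι s ≠ 0 := by
      intro s
      obtain ⟨a, ha, ea⟩ := hS' s s.2
      rw [← ea]
      exact (map_ne_zero_iff ι hι).2 ((map_ne_zero_iff j hj).2 ha)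
    let fS : mappedNonzero F H →* (OreLocalization (nonZeroDivisors (MonoidAlgebra F G))
        (MonoidAlgebra F G))ˣ :=
      { toFun := fun s => Units.mk0 (ι s) (hne s)
        map_one' := Units.ext (by simp)
        map_mul' := fun x y => Units.ext (by simp) }
    have hfS : ∀ s : mappedNonzero F H, ι s = fS s := fun s => rfl
    refine ⟨RingEquiv.ofBijective (universalHom ι fS hfS) ⟨?_, ?_⟩⟩
    · rw [injective_iff_map_eq_zero]
      intro x
      induction x using OreLocalization.ind with
      | _ r s =>
        intro h
        rw [universalHom_apply, Units.mul_right_eq_zero] at h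
        have : r = 0 := hι (by rw [h, map_zero])
        rw [this, OreLocalization.zero_oreDiv]
    · intro x
      obtain ⟨s, r, hs, e⟩ := h1 x
      refine ⟨r /ₒ ⟨j s, hS s hs⟩, ?_⟩
      rw [universalHom_apply, Units.inv_mul_eq_iff_eq_mul, ← hfS]
      exact e.symm
  · haveI := strongRank_of_inv _ (divisionClosure_inv (Set.range (ι.comp j)))
    have hr := rank_eq_card_basis b
    rw [← Nat.card_eq_fintype_card, hcard] at hr
    exact hr
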